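/- Let p > 1, μ ∈ ℝ, and W(t) = |t − μ|^{p+1}, so that W'(t) = (p+1)|t − μ|^{p−1}(t − μ). Let Ω ⊊ ℝⁿ be a domain. Then there exists a positive constant C, depending only on p and n, such that every classical solution u of Δu = W'(u) in Ω satisfies |μ − u(x)| + |∇u(x)|^{2/(p+1)} ≤ C · dist(x, ∂Ω)^{−2/(p−1)} for all x ∈ Ω. In particular, if Ω contains the exterior region {x ∈ ℝⁿ : |x| > R} for some R > 0, then |μ − u(x)| + |∇u(x)|^{2/(p+1)} ≤ C |x|^{−2/(p−1)} for all |x| ≥ 2R. -/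

import Mathlib

open Metric Set Filter Pointwise

noncomputable section

/-- The Laplacian of `u : ℝⁿ → ℝ`: the sum of the second partial derivatives. -/
def lap {n : ℕ} (u : EuclideanSpace ℝ (Fin n) → ℝ) (x : EuclideanSpace ℝ (Fin n)) : ℝ :=
  ∑ i : Fin n, fderiv ℝ (fun y => fderiv ℝ u y (EuclideanSpace.single i 1)) x
    (EuclideanSpace.single i 1)

/-- Condition (a'): `W` is `C²`, `μ > 0`, `W μ = 0`, `W > 0` on `[0, μ)`, `W ≥ 0` everywhere,
and either `W(-t) ≥ W(t)` on `[0, μ]` or `W' < 0` on `(-∞, 0)`. -/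
def CondA' (W : ℝ → ℝ) (μ : ℝ) : Prop :=
  ContDiff ℝ 2 W ∧ 0 < μ ∧ W μ = 0 ∧ (∀ t ∈ Set.Ico (0:ℝ) μ, 0 < W t) ∧
    (∀ t : ℝ, 0 ≤ W t) ∧
    ((∀ t ∈ Set.Icc (0:ℝ) μ, W t ≤ W (-t)) ∨ (∀ t < (0:ℝ), deriv W t < 0))

/-- `U` is the heteroclinic profile: `U'' = W'(U)` on `(0, ∞)`, `U 0 = 0`, `U → μ` at `∞`. -/
def IsHetero (W : ℝ → ℝ) (μ : ℝ) (U : ℝ → ℝ) : Prop :=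
  ContDiffOn ℝ 2 U (Set.Ici 0) ∧ U 0 = 0 ∧
    (∀ s > (0:ℝ), deriv (deriv U) s = deriv W (U s)) ∧
    Filter.Tendsto U Filter.atTop (nhds μ)

/-- `Ω` has boundary of class `C²`, via local `C²` defining functions. -/
def HasC2Boundary {n : ℕ} (Ω : Set (EuclideanSpace ℝ (Fin n))) : Prop :=
  ∀ x ∈ frontier Ω, ∃ (V : Set (EuclideanSpace ℝ (Fin n))) (f : EuclideanSpace ℝ (Fin n) → ℝ),
    IsOpen V ∧ x ∈ V ∧ ContDiffOn ℝ 2 f V ∧ (∀ y ∈ V, fderiv ℝ f y ≠ 0) ∧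
    Ω ∩ V = {y ∈ V | f y < 0} ∧ frontier Ω ∩ V = {y ∈ V | f y = 0}

variable {n : ℕ}

lemma second_le_of_max {E : Type*} [NormedAddCommGroup E] [NormedSpace ℝ E] (f : E → ℝ) (x e : E)
    (hf : ContDiffAt ℝ 2 f x) (hm : IsLocalMax f x) :
    fderiv ℝ (fun y => fderiv ℝ f y e) x e ≤ 0 := by
  by_contra hcon
  push Not at hcon
  set h : ℝ → ℝ := fun t => f (x + t • e) with hh
  have hline : ∀ t : ℝ, HasDerivAt (fun t : ℝ => x + t • e) e t := by
    intro t
    simpa using ((hasDerivAt_id t).smul_const e).const_add x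
  have htend : Tendsto (fun t : ℝ => x + t • e) (nhds 0) (nhds x) := by
    have := (hline 0).continuousAt.tendsto
    simpa using this
  have hdiff : ∀ᶠ y in nhds x, DifferentiableAt ℝ f y := by
    filter_upwards [hf.eventually (by simp)] with y hy
    exact hy.differentiableAt (by simp)
  have hd : ∀ᶠ t in nhds (0:ℝ), deriv h t = fderiv ℝ f (x + t • e) e := by
    filter_upwards [htend.eventually hdiff] with t ht
    exact (ht.hasFDerivAt.comp_hasDerivAt t (hline t)).deriv
  have hD : DifferentiableAt ℝ (fun y => fderiv ℝ f y e) x :=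
    ((hf.fderiv_right (m := 1) (by norm_num)).differentiableAt (by simp)).clm_apply
      (differentiableAt_const e)
  have hdd : deriv (deriv h) 0 = fderiv ℝ (fun y => fderiv ℝ f y e) x e := by
    rw [EventuallyEq.deriv_eq hd]
    have h1 : HasFDerivAt (fun y => fderiv ℝ f y e) (fderiv ℝ (fun y => fderiv ℝ f y e) x)
      (x + (0:ℝ) • e) := by simpa using hD.hasFDerivAt
    exact (h1.comp_hasDerivAt 0 (hline 0)).deriv
  have hmax : IsLocalMax h 0 := by
    have := htend.eventually hm
    filter_upwards [this] with t ht
    simpa [hh] using ht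
  have hcont : ContinuousAt h 0 := by
    have h1 : ContinuousAt f (x + (0:ℝ) • e) := by simpa using hf.continuousAt
    exact ContinuousAt.comp (f := fun t : ℝ => x + t • e) h1 (hline 0).continuousAt
  have hmin := isLocalMin_of_deriv_deriv_pos (by rw [hdd]; exact hcon) hmax.deriv_eq_zero hcont
  have hconst : h =ᶠ[nhds 0] fun _ => h 0 := by
    filter_upwards [hmax, hmin] with t h1 h2
    exact le_antisymm h1 h2
  have h0 : deriv (deriv h) 0 = 0 := by
    rw [(hconst.deriv).deriv_eq]; simp
  linarith

lemma lap_le_of_max (f : EuclideanSpace ℝ (Fin n) → ℝ) (x : EuclideanSpace ℝ (Fin n))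
    (hf : ContDiffAt ℝ 2 f x) (hm : IsLocalMax f x) : lap f x ≤ 0 :=
  Finset.sum_nonpos fun _ _ => second_le_of_max f x _ hf hm

lemma diff_partial {f : EuclideanSpace ℝ (Fin n) → ℝ} {x : EuclideanSpace ℝ (Fin n)}
    (hf : ContDiffAt ℝ 2 f x) (e : EuclideanSpace ℝ (Fin n)) :
    DifferentiableAt ℝ (fun y => fderiv ℝ f y e) x :=
  ((hf.fderiv_right (m := 1) (by norm_num)).differentiableAt (by simp)).clm_apply
      (differentiableAt_const e)

lemma ev_diff {f : EuclideanSpace ℝ (Fin n) → ℝ} {x : EuclideanSpace ℝ (Fin n)}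
    (hf : ContDiffAt ℝ 2 f x) : ∀ᶠ y in nhds x, DifferentiableAt ℝ f y := by
  filter_upwards [hf.eventually (by simp)] with y hy
  exact hy.differentiableAt (by simp)

lemma lap_sub (f g : EuclideanSpace ℝ (Fin n) → ℝ) (x : EuclideanSpace ℝ (Fin n))
    (hf : ContDiffAt ℝ 2 f x) (hg : ContDiffAt ℝ 2 g x) :
    lap (fun y => f y - g y) x = lap f x - lap g x := by
  unfold lap
  rw [← Finset.sum_sub_distrib]
  refine Finset.sum_congr rfl fun i _ => ?_
  have h1 : (fun y => fderiv ℝ (fun y => f y - g y) y (EuclideanSpace.single i 1)) =ᶠ[nhds x]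
      fun y => fderiv ℝ f y (EuclideanSpace.single i 1) -
        fderiv ℝ g y (EuclideanSpace.single i 1) := by
    filter_upwards [ev_diff hf, ev_diff hg] with y h1 h2
    rw [fderiv_fun_sub h1 h2]; rfl
  rw [h1.fderiv_eq, fderiv_fun_sub (diff_partial hf _) (diff_partial hg _)]; rfl

lemma lap_const_mul (c : ℝ) (f : EuclideanSpace ℝ (Fin n) → ℝ) (x : EuclideanSpace ℝ (Fin n))
    (hf : ContDiffAt ℝ 2 f x) :
    lap (fun y => c * f y) x = c * lap f x := by
  unfold lap
  rw [Finset.mul_sum]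
  refine Finset.sum_congr rfl fun i _ => ?_
  have h1 : (fun y => fderiv ℝ (fun y => c * f y) y (EuclideanSpace.single i 1)) =ᶠ[nhds x]
      fun y => c * fderiv ℝ f y (EuclideanSpace.single i 1) := by
    filter_upwards [ev_diff hf] with y h1
    rw [fderiv_const_mul h1]; rfl
  rw [h1.fderiv_eq, fderiv_const_mul (diff_partial hf _)]; rfl

lemma lap_translate (f : EuclideanSpace ℝ (Fin n) → ℝ) (a x : EuclideanSpace ℝ (Fin n)) (μ : ℝ) :
    lap (fun y => f (a + y) - μ) x = lap f (a + x) := by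
  unfold lap
  refine Finset.sum_congr rfl fun i _ => ?_
  have : (fun y => fderiv ℝ (fun y => f (a + y) - μ) y (EuclideanSpace.single i 1)) =
      fun y => (fun z => fderiv ℝ f z (EuclideanSpace.single i 1)) (a + y) := by
    ext y
    rw [fderiv_sub_const, fderiv_comp_add_left]
  rw [this]
  exact congrArg (fun L : EuclideanSpace ℝ (Fin n) →L[ℝ] ℝ => L (EuclideanSpace.single i 1)) 
    (fderiv_comp_add_left (𝕜 := ℝ) (f := fun z => fderiv ℝ f z (EuclideanSpace.single i 1)) a)

/-- reflection flipping the `i`-th coordinate -/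
def cflip (i : Fin n) : EuclideanSpace ℝ (Fin n) ≃ₗᵢ[ℝ] EuclideanSpace ℝ (Fin n) :=
  (Submodule.span ℝ {(EuclideanSpace.single i 1 : EuclideanSpace ℝ (Fin n))})ᗮ.reflection

lemma cflip_self (i : Fin n) : cflip i (EuclideanSpace.single i 1) = -EuclideanSpace.single i 1 :=
  Submodule.reflection_orthogonalComplement_singleton_eq_neg _

lemma cflip_of_zero (i : Fin n) (x : EuclideanSpace ℝ (Fin n)) (hx : x i = 0) : cflip i x = x := by
  apply Submodule.reflection_mem_subspace_eq_self
  rw [Submodule.mem_orthogonal_singleton_iff_inner_right]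
  simp [EuclideanSpace.inner_single_left, hx]

lemma lap_refl (i : Fin n) (f : EuclideanSpace ℝ (Fin n) → ℝ) (x : EuclideanSpace ℝ (Fin n)) :
    lap (fun y => f (cflip i y)) x = lap f (cflip i x) := by
  unfold lap
  refine Finset.sum_congr rfl fun j _ => ?_
  have key : ∀ (g : EuclideanSpace ℝ (Fin n) → ℝ) y v,
      fderiv ℝ (fun y => g (cflip i y)) y v = fderiv ℝ g (cflip i y) (cflip i v) := by
    intro g y v
    have := (cflip i).toContinuousLinearEquiv.comp_right_fderiv (f := g) (x := y)
    change fderiv ℝ (g ∘ cflip i) y v = _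
    exact congrArg (fun L : EuclideanSpace ℝ (Fin n) →L[ℝ] ℝ => L v) this
  simp_rw [key]
  rw [key (fun z => fderiv ℝ f z (cflip i (EuclideanSpace.single j 1)))]
  by_cases hij : j = i
  · subst hij
    rw [cflip_self]
    simp only [map_neg, fderiv_fun_neg, neg_apply, neg_neg]
  · rw [cflip_of_zero i _ (by simp [Ne.symm hij])]

lemma opnorm_le (L : EuclideanSpace ℝ (Fin n) →L[ℝ] ℝ) (B : ℝ)
    (h : ∀ i, |L (EuclideanSpace.single i 1)| ≤ B) : ‖L‖ ≤ n * B := by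
  rcases Nat.eq_zero_or_pos n with hn | hn
  · subst hn
    have : L = 0 := Subsingleton.elim _ _
    simp [this]
  have hB : 0 ≤ B := (abs_nonneg _).trans (h ⟨0, hn⟩)
  refine L.opNorm_le_bound (by positivity) fun x => ?_
  have hx : x = ∑ i, x i • (EuclideanSpace.single i (1:ℝ) : EuclideanSpace ℝ (Fin n)) := by
    have := (EuclideanSpace.basisFun (Fin n) ℝ).sum_repr x
    simpa using this.symm
  calc ‖L x‖ = ‖∑ i, x i * L (EuclideanSpace.single i 1)‖ := by
        conv_lhs => rw [hx]
        simp [map_sum]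
    _ ≤ ∑ i, ‖x i * L (EuclideanSpace.single i 1)‖ := norm_sum_le _ _
    _ ≤ ∑ i : Fin n, ‖x‖ * B := by
        refine Finset.sum_le_sum fun i _ => ?_
        rw [norm_mul]
        exact mul_le_mul (PiLp.norm_apply_le x i) (h i) (norm_nonneg _) (norm_nonneg _)
    _ = n * B * ‖x‖ := by simp; ring

lemma hasFDerivAt_g (r : ℝ) (x : EuclideanSpace ℝ (Fin n)) :
    HasFDerivAt (fun y : EuclideanSpace ℝ (Fin n) => r ^ 2 - ‖y‖ ^ 2) (-(2 • innerSL ℝ x)) x :=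
  (hasStrictFDerivAt_norm_sq x).hasFDerivAt.const_sub _

lemma hasFDerivAt_coord (i : Fin n) (x : EuclideanSpace ℝ (Fin n)) :
    HasFDerivAt (fun y : EuclideanSpace ℝ (Fin n) => y i)
      (EuclideanSpace.proj i : EuclideanSpace ℝ (Fin n) →L[ℝ] ℝ) x :=
  (EuclideanSpace.proj i : EuclideanSpace ℝ (Fin n) →L[ℝ] ℝ).hasFDerivAt

lemma lap_G (r a : ℝ) (x : EuclideanSpace ℝ (Fin n)) (hx : 0 < r ^ 2 - ‖x‖ ^ 2) :
    lap (fun y => (r ^ 2 - ‖y‖ ^ 2) ^ (-a)) x =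
      2 * a * n * (r ^ 2 - ‖x‖ ^ 2) ^ (-a - 1) +
      4 * a * (a + 1) * ‖x‖ ^ 2 * (r ^ 2 - ‖x‖ ^ 2) ^ (-a - 2) := by
  have hpos : ∀ᶠ y : EuclideanSpace ℝ (Fin n) in nhds x, 0 < r ^ 2 - ‖y‖ ^ 2 :=
    (hasFDerivAt_g r x).continuousAt.eventually (lt_mem_nhds hx)
  have h1 : ∀ i : Fin n,
      (fun y => fderiv ℝ (fun y : EuclideanSpace ℝ (Fin n) => (r ^ 2 - ‖y‖ ^ 2) ^ (-a)) y
        (EuclideanSpace.single i 1)) =ᶠ[nhds x]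
      fun y => (2 * a) * (y i * (r ^ 2 - ‖y‖ ^ 2) ^ (-a - 1)) := by
    intro i
    filter_upwards [hpos] with y hy
    rw [((hasFDerivAt_g r y).rpow_const (p := -a) (Or.inl hy.ne')).fderiv]
    simp [EuclideanSpace.inner_single_right]
    ring
  have h2 : ∀ i : Fin n, fderiv ℝ (fun y : EuclideanSpace ℝ (Fin n) =>
      (2 * a) * (y i * (r ^ 2 - ‖y‖ ^ 2) ^ (-a - 1))) x (EuclideanSpace.single i 1) =
      2 * a * (r ^ 2 - ‖x‖ ^ 2) ^ (-a - 1) +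
      4 * a * (a + 1) * (x i) ^ 2 * (r ^ 2 - ‖x‖ ^ 2) ^ (-a - 2) := by
    intro i
    rw [(((hasFDerivAt_coord i x).fun_mul ((hasFDerivAt_g r x).rpow_const (p := -a - 1)
      (Or.inl hx.ne'))).const_mul (2 * a)).fderiv]
    have : -a - 1 - 1 = -a - 2 := by ring
    simp [EuclideanSpace.inner_single_right, this]
    ring
  unfold lap
  rw [Finset.sum_congr rfl fun i _ => by rw [(h1 i).fderiv_eq, h2 i]]
  rw [Finset.sum_add_distrib, Finset.sum_const, ← Finset.sum_mul, ← Finset.mul_sum,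
    ← EuclideanSpace.real_norm_sq_eq]
  simp
  ring

lemma lap_psi (i : Fin n) (A B r : ℝ) (x : EuclideanSpace ℝ (Fin n)) :
    lap (fun y => A * ‖y‖ ^ 2 + B * (y i * (r - y i))) x = 2 * n * A - 2 * B := by
  have h1 : ∀ j : Fin n,
      (fun y => fderiv ℝ (fun y : EuclideanSpace ℝ (Fin n) =>
        A * ‖y‖ ^ 2 + B * (y i * (r - y i))) y (EuclideanSpace.single j 1)) =
      fun y => 2 * A * y j + (if i = j then 1 else 0) * B * (r - 2 * y i) := by
    intro j
    ext y
    rw [(((hasStrictFDerivAt_norm_sq y).hasFDerivAt.const_mul A).fun_add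
      (((hasFDerivAt_coord i y).fun_mul ((hasFDerivAt_coord i y).const_sub r)).const_mul B)).fderiv]
    simp [EuclideanSpace.inner_single_right]
    split_ifs <;> ring
  have h2 : ∀ j : Fin n, fderiv ℝ (fun y : EuclideanSpace ℝ (Fin n) =>
      2 * A * y j + (if i = j then 1 else 0) * B * (r - 2 * y i)) x (EuclideanSpace.single j 1) =
      2 * A - (if i = j then 2 * B else 0) := by
    intro j
    rw [(((hasFDerivAt_coord j x).const_mul (2 * A)).fun_add
      ((((hasFDerivAt_coord i x).const_mul 2).const_sub r).const_mul
        ((if i = j then 1 else 0) * B))).fderiv]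
    by_cases hij : i = j
    · subst hij
      simp
      ring
    · have : (EuclideanSpace.single j (1:ℝ) : EuclideanSpace ℝ (Fin n)) i = 0 := by simp [hij]
      simp [hij]
  unfold lap
  rw [Finset.sum_congr rfl fun j _ => by rw [h1 j, h2 j]]
  simp
  ring

lemma ko_upper (p : ℝ) (hp : 1 < p) (r : ℝ) (hr : 0 < r) (v : EuclideanSpace ℝ (Fin n) → ℝ)
    (hv : ∀ y ∈ closedBall (0 : EuclideanSpace ℝ (Fin n)) r, ContDiffAt ℝ 2 v y)
    (hl : ∀ y ∈ closedBall (0 : EuclideanSpace ℝ (Fin n)) r,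
      lap v y = (p + 1) * |v y| ^ (p - 1) * v y) (a L : ℝ) (ha : a = 2 / (p - 1))
    (hL : L = 2 * a * n + 4 * a * (a + 1)) :
    v 0 ≤ (L / (p + 1)) ^ (1 / (p - 1)) * r ^ (-a) := by
  have hp1 : 0 < p - 1 := by linarith
  have ha0 : 0 < a := by rw [ha]; positivity
  have hL0 : 0 < L := by rw [hL]; positivity
  rcases le_or_gt (v 0) 0 with h0 | h0
  · exact h0.trans (by positivity)
  set w : EuclideanSpace ℝ (Fin n) → ℝ := fun y => v y * (r ^ 2 - ‖y‖ ^ 2) ^ a with hw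
  have hwc : ContinuousOn w (closedBall 0 r) := by
    apply ContinuousOn.mul (fun y hy => (hv y hy).continuousAt.continuousWithinAt)
    apply ContinuousOn.rpow_const (by fun_prop)
    intro y _; exact Or.inr ha0.le
  obtain ⟨x, hx, hmax⟩ := (isCompact_closedBall (0 : EuclideanSpace ℝ (Fin n)) r).exists_isMaxOn
    ⟨0, by simp [hr.le]⟩ hwc
  have hw0 : w 0 = v 0 * r ^ (2 * a) := by
    simp only [hw, norm_zero]
    rw [Real.rpow_mul hr.le]; norm_num
  have hm0 : w 0 ≤ w x := hmax (by simp [hr.le])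
  have hwx : 0 < w x := lt_of_lt_of_le (by rw [hw0]; positivity) hm0
  have hxr : ‖x‖ ≤ r := by simpa using hx
  have hg : 0 < r ^ 2 - ‖x‖ ^ 2 := by
    have : 0 ≤ r ^ 2 - ‖x‖ ^ 2 := by nlinarith [norm_nonneg x]
    rcases this.lt_or_eq with h | h
    · exact h
    · exfalso
      simp only [hw, ← h, Real.zero_rpow ha0.ne', mul_zero] at hwx
      exact lt_irrefl _ hwx
  have hxr' : ‖x‖ < r := by nlinarith [norm_nonneg x]
  have hvx : v x = w x * (r ^ 2 - ‖x‖ ^ 2) ^ (-a) := by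
    simp only [hw]
    rw [mul_assoc, ← Real.rpow_add hg]; simp
  have hGc : ContDiffAt ℝ 2 (fun y : EuclideanSpace ℝ (Fin n) => (r ^ 2 - ‖y‖ ^ 2) ^ (-a)) x :=
    ContDiffAt.rpow_const_of_ne (contDiffAt_const.sub (contDiff_norm_sq ℝ).contDiffAt) hg.ne'
  have hloc : IsLocalMax (fun y => v y - w x * (r ^ 2 - ‖y‖ ^ 2) ^ (-a)) x := by
    have hb : ∀ᶠ y in nhds x, y ∈ ball (0 : EuclideanSpace ℝ (Fin n)) r :=
      isOpen_ball.mem_nhds (by simpa using hxr')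
    filter_upwards [hb] with y hy
    have hyr : ‖y‖ < r := by simpa using hy
    have hgy : 0 < r ^ 2 - ‖y‖ ^ 2 := by nlinarith [norm_nonneg y]
    have h1 : w y ≤ w x := hmax (ball_subset_closedBall hy)
    have h2 : v y = w y * (r ^ 2 - ‖y‖ ^ 2) ^ (-a) := by
      simp only [hw]
      rw [mul_assoc, ← Real.rpow_add hgy]; simp
    rw [← hvx, sub_self, h2, sub_nonpos]
    gcongr
  have hlap := lap_le_of_max _ x ((hv x hx).sub (contDiffAt_const.mul hGc)) hloc
  rw [lap_sub _ _ _ (hv x hx) (contDiffAt_const.mul hGc), lap_const_mul _ _ _ hGc, lap_G _ _ _ hg,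
    hl x hx] at hlap
  set g := r ^ 2 - ‖x‖ ^ 2 with hgdef
  have hvx0 : 0 < v x := by rw [hvx]; positivity
  rw [abs_of_pos hvx0] at hlap
  have e1 : (v x) ^ (p - 1) * v x = (w x) ^ (p - 1) * w x * g ^ (-a - 2) := by
    rw [hvx, Real.mul_rpow hwx.le (by positivity), ← Real.rpow_mul hg.le]
    have : -a * (p - 1) = -2 := by rw [ha]; field_simp
    rw [this]
    have : g ^ (-a - 2) = g ^ (-2:ℝ) * g ^ (-a) := by
      rw [← Real.rpow_add hg]; ring_nf
    rw [this]; ring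
  have e2 : g ^ (-a - 1) = g * g ^ (-a - 2) := by
    nth_rw 2 [← Real.rpow_one g]
    rw [← Real.rpow_add hg]; ring_nf
  have hG2 : 0 < g ^ (-a - 2) := by positivity
  rw [mul_assoc, e1, e2] at hlap
  have h3 : (p + 1) * (w x) ^ (p - 1) ≤ L * r ^ 2 := by
    have h4 : (p + 1) * (w x) ^ (p - 1) ≤ 2 * a * n * g + 4 * a * (a + 1) * ‖x‖ ^ 2 := by
      have hpos : 0 < w x * g ^ (-a - 2) := by positivity
      refine le_of_mul_le_mul_right ?_ hpos
      nlinarith [hlap]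
    refine h4.trans ?_
    rw [hL, add_mul]
    have : g ≤ r ^ 2 := by rw [hgdef]; nlinarith [norm_nonneg x]
    have : ‖x‖ ^ 2 ≤ r ^ 2 := by nlinarith [norm_nonneg x]
    gcongr
  have h5 : w x ≤ (L / (p + 1)) ^ (1 / (p - 1)) * r ^ a := by
    have h6 : (w x) ^ (p - 1) ≤ L / (p + 1) * r ^ 2 := by
      rw [div_mul_eq_mul_div, le_div_iff₀ (by linarith)]; linarith
    have h7 := Real.rpow_le_rpow (by positivity) h6 (z := 1 / (p - 1)) (by positivity)
    rw [← Real.rpow_mul hwx.le, mul_one_div_cancel hp1.ne', Real.rpow_one,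
      Real.mul_rpow (by positivity) (by positivity)] at h7
    have : (r ^ 2) ^ (1 / (p - 1)) = r ^ a := by
      rw [← Real.rpow_natCast r 2, ← Real.rpow_mul hr.le, ha]; congr 1; push_cast; ring
    rwa [this] at h7
  have h8 : v 0 * r ^ (2 * a) ≤ (L / (p + 1)) ^ (1 / (p - 1)) * r ^ a := hw0 ▸ hm0.trans h5
  have h9 : r ^ a = r ^ (-a) * r ^ (2 * a) := by
    rw [← Real.rpow_add hr]; ring_nf
  rw [h9, ← mul_assoc] at h8
  exact le_of_mul_le_mul_right h8 (by positivity)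

lemma lap_neg (v : EuclideanSpace ℝ (Fin n) → ℝ) (x) (hv : ContDiffAt ℝ 2 v x) :
    lap (fun y => - v y) x = - lap v x := by
  have := lap_const_mul (-1) v x hv
  simpa using this

lemma ko_abs (p : ℝ) (hp : 1 < p) (r : ℝ) (hr : 0 < r) (v : EuclideanSpace ℝ (Fin n) → ℝ)
    (hv : ∀ y ∈ closedBall (0 : EuclideanSpace ℝ (Fin n)) r, ContDiffAt ℝ 2 v y)
    (hl : ∀ y ∈ closedBall (0 : EuclideanSpace ℝ (Fin n)) r,
      lap v y = (p + 1) * |v y| ^ (p - 1) * v y) (a L : ℝ) (ha : a = 2 / (p - 1))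
    (hL : L = 2 * a * n + 4 * a * (a + 1)) :
    |v 0| ≤ (L / (p + 1)) ^ (1 / (p - 1)) * r ^ (-a) := by
  refine abs_le'.2 ⟨ko_upper p hp r hr v hv hl a L ha hL, ?_⟩
  refine ko_upper p hp r hr (fun y => - v y) (fun y hy => (hv y hy).neg) ?_ a L ha hL
  intro y hy
  rw [lap_neg _ _ (hv y hy), hl y hy, abs_neg]; ring

lemma deriv_nonpos_of (f : ℝ → ℝ) (d r : ℝ) (hr : 0 < r) (hf : HasDerivAt f d 0) (h0 : f 0 = 0)
    (hle : ∀ t ∈ Ioo 0 r, f t ≤ 0) : d ≤ 0 := by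
  have h1 := hf.tendsto_slope_zero_right
  refine le_of_tendsto h1 ?_
  filter_upwards [Ioo_mem_nhdsGT hr] with t ht
  have := hle t ht
  simp only [zero_add, h0, sub_zero, smul_eq_mul]
  exact mul_nonpos_of_nonneg_of_nonpos (inv_nonneg.2 ht.1.le) this

lemma grad_upper (i : Fin n) (r : ℝ) (hr : 0 < r) (v : EuclideanSpace ℝ (Fin n) → ℝ) (M N : ℝ)
    (hv : ∀ y ∈ closedBall (0 : EuclideanSpace ℝ (Fin n)) r, ContDiffAt ℝ 2 v y)
    (hM : ∀ y ∈ closedBall (0 : EuclideanSpace ℝ (Fin n)) r, |v y| ≤ M)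
    (hN : ∀ y ∈ closedBall (0 : EuclideanSpace ℝ (Fin n)) r, |lap v y| < N) :
    fderiv ℝ v 0 (EuclideanSpace.single i 1) ≤ n * M / r + N * r / 2 := by
  have h00 : (0 : EuclideanSpace ℝ (Fin n)) ∈ closedBall (0 : EuclideanSpace ℝ (Fin n)) r := by
    simp [hr.le]
  have hM0 : 0 ≤ M := (abs_nonneg _).trans (hM 0 h00)
  have hN0 : 0 < N := (abs_nonneg _).trans_lt (hN 0 h00)
  set B : ℝ := n * M / r ^ 2 + N / 2 with hB
  have hB0 : 0 < B := by positivity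
  set A : ℝ := M / r ^ 2 with hA
  have hA0 : 0 ≤ A := by positivity
  set ψ : EuclideanSpace ℝ (Fin n) → ℝ := fun y => A * ‖y‖ ^ 2 + B * (y i * (r - y i)) with hψ
  set F : EuclideanSpace ℝ (Fin n) → ℝ :=
    fun y => (1 / 2) * (v y - v (cflip i y)) - ψ y with hF
  have hσ : ∀ y ∈ closedBall (0 : EuclideanSpace ℝ (Fin n)) r, cflip i y ∈
      closedBall (0 : EuclideanSpace ℝ (Fin n)) r := by
    intro y hy; simpa using hy
  have hvσ : ∀ y ∈ closedBall (0 : EuclideanSpace ℝ (Fin n)) r,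
      ContDiffAt ℝ 2 (fun y => v (cflip i y)) y := fun y hy =>
    ContDiffAt.comp y (hv _ (hσ y hy)) (cflip i).contDiff.contDiffAt
  have hψc : ContDiff ℝ 2 ψ := by
    have h1 : ContDiff ℝ 2 (fun y : EuclideanSpace ℝ (Fin n) => y i) :=
      (EuclideanSpace.proj i : EuclideanSpace ℝ (Fin n) →L[ℝ] ℝ).contDiff
    exact (contDiff_const.mul (contDiff_norm_sq ℝ)).add
      (contDiff_const.mul (h1.mul (contDiff_const.sub h1)))
  have hφc : ∀ y ∈ closedBall (0 : EuclideanSpace ℝ (Fin n)) r,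
      ContDiffAt ℝ 2 (fun y => (1 / 2) * (v y - v (cflip i y))) y := fun y hy =>
    contDiffAt_const.mul ((hv y hy).sub (hvσ y hy))
  have hFc : ∀ y ∈ closedBall (0 : EuclideanSpace ℝ (Fin n)) r, ContDiffAt ℝ 2 F y :=
    fun y hy => (hφc y hy).sub hψc.contDiffAt
  have hlapF : ∀ y ∈ closedBall (0 : EuclideanSpace ℝ (Fin n)) r, 0 < lap F y := by
    intro y hy
    rw [hF, lap_sub _ _ _ (hφc y hy) hψc.contDiffAt, lap_const_mul _ _ _ ((hv y hy).sub (hvσ y hy)),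
      lap_sub _ _ _ (hv y hy) (hvσ y hy), lap_refl, hψ, lap_psi]
    have h1 := abs_lt.1 (hN y hy)
    have h2 := abs_lt.1 (hN _ (hσ y hy))
    have : 2 * (n:ℝ) * A - 2 * B = - N := by rw [hB, hA]; ring
    linarith [h1.1, h2.2]
  set H : Set (EuclideanSpace ℝ (Fin n)) := closedBall 0 r ∩ {y | 0 ≤ y i} with hH
  have hcoord : Continuous (fun y : EuclideanSpace ℝ (Fin n) => y i) := by fun_prop
  have hHc : IsCompact H := (isCompact_closedBall _ _).inter_right
    (isClosed_le continuous_const hcoord)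
  obtain ⟨x, hx, hmax⟩ := hHc.exists_isMaxOn ⟨0, h00, by simp⟩
    (fun y hy => (hFc y hy.1).continuousAt.continuousWithinAt)
  have hFx : F x ≤ 0 := by
    have hxr : ‖x‖ ≤ r := by simpa using hx.1
    have hxi : 0 ≤ x i := hx.2
    have hxi' : x i ≤ r := (le_abs_self _).trans ((PiLp.norm_apply_le x i).trans hxr)
    rcases hxi.eq_or_lt with h | h
    · simp only [hF, hψ]
      rw [cflip_of_zero i x h.symm, ← h]
      have : 0 ≤ A * ‖x‖ ^ 2 := by positivity
      linarith
    rcases hxr.eq_or_lt with h' | h'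
    · simp only [hF, hψ]
      rw [h']
      have e : A * r ^ 2 = M := by rw [hA]; field_simp
      have h1 := abs_le.1 (hM x hx.1)
      have h2 := abs_le.1 (hM _ (hσ x hx.1))
      have h3 : 0 ≤ B * (x i * (r - x i)) :=
        mul_nonneg hB0.le (mul_nonneg hxi (by linarith))
      rw [e]; linarith [h1.2, h2.1]
    · exfalso
      have hloc : IsLocalMax F x := by
        have hb : ∀ᶠ y in nhds x, y ∈ ball (0 : EuclideanSpace ℝ (Fin n)) r :=
          isOpen_ball.mem_nhds (by simpa using h')
        have hc : ∀ᶠ y in nhds x, 0 < y i := hcoord.continuousAt.eventually (lt_mem_nhds h)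
        filter_upwards [hb, hc] with y h1 h2
        exact hmax ⟨ball_subset_closedBall h1, h2.le⟩
      exact absurd (lap_le_of_max F x (hFc x hx.1) hloc) (not_le.2 (hlapF x hx.1))
  -- the one-dimensional slice
  set e : EuclideanSpace ℝ (Fin n) := EuclideanSpace.single i 1 with he
  have hne : ‖e‖ = 1 := by simp [he]
  have hline : ∀ c : ℝ, HasDerivAt (fun t : ℝ => (c * t) • e) (c • e) 0 := by
    intro c
    simpa using ((hasDerivAt_id (0:ℝ)).const_mul c).smul_const e
  have hv0 : HasFDerivAt v (fderiv ℝ v 0) 0 := ((hv 0 h00).differentiableAt (by simp)).hasFDerivAt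
  have hvd : ∀ c : ℝ, HasDerivAt (fun t : ℝ => v ((c * t) • e)) (c * fderiv ℝ v 0 e) 0 := by
    intro c
    have h1 : HasFDerivAt v (fderiv ℝ v 0) ((c * (0:ℝ)) • e) := by simpa using hv0
    exact (h1.comp_hasDerivAt 0 (hline c)).congr_deriv (by simp)
  have hder : HasDerivAt (fun t : ℝ => (1 / 2) * (v ((1 * t) • e) - v ((-1 * t) • e)) -
      (A * t ^ 2 + B * (t * (r - t)))) (fderiv ℝ v 0 e - B * r) 0 := by
    have h1 := (((hvd 1).sub (hvd (-1))).const_mul (1 / 2)).sub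
      ((((hasDerivAt_id (0:ℝ)).pow 2).const_mul A).add
        (((hasDerivAt_id (0:ℝ)).mul ((hasDerivAt_id (0:ℝ)).const_sub r)).const_mul B))
    refine (h1.congr_deriv ?_)
    simp; ring
  have := deriv_nonpos_of _ _ r hr hder (by simp) (by
    intro t ht
    have hmem : t • e ∈ H := by
      refine ⟨?_, ?_⟩
      · simp [norm_smul, hne, abs_of_pos ht.1, ht.2.le]
      · simp [he, ht.1.le]
    have h1 : F (t • e) ≤ 0 := (hmax hmem).trans hFx
    have h2 : cflip i (t • e) = (-1 * t) • e := by
      rw [map_smul, he, cflip_self]; simp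
    simp only [hF, hψ, h2, norm_smul, hne] at h1
    have h3 : (t • e) i = t := by simp [he]
    rw [h3] at h1
    simpa using h1)
  have e2 : B * r = n * M / r + N * r / 2 := by rw [hB]; field_simp
  linarith

lemma grad_bound (r : ℝ) (hr : 0 < r) (v : EuclideanSpace ℝ (Fin n) → ℝ) (M N : ℝ)
    (hv : ∀ y ∈ closedBall (0 : EuclideanSpace ℝ (Fin n)) r, ContDiffAt ℝ 2 v y)
    (hM : ∀ y ∈ closedBall (0 : EuclideanSpace ℝ (Fin n)) r, |v y| ≤ M)
    (hN : ∀ y ∈ closedBall (0 : EuclideanSpace ℝ (Fin n)) r, |lap v y| < N) :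
    ‖fderiv ℝ v 0‖ ≤ n * (n * M / r + N * r / 2) := by
  refine opnorm_le _ _ fun i => abs_le'.2 ⟨grad_upper i r hr v M N hv hM hN, ?_⟩
  have := grad_upper i r hr (fun y => - v y) M N (fun y hy => (hv y hy).neg)
    (fun y hy => by simpa using hM y hy)
    (fun y hy => by rw [lap_neg _ _ (hv y hy), abs_neg]; exact hN y hy)
  rwa [fderiv_fun_neg] at this

lemma closedBall_subset_of_frontier (Ω : Set (EuclideanSpace ℝ (Fin n))) (hΩ : IsOpen Ω)
    (x : EuclideanSpace ℝ (Fin n)) (hx : x ∈ Ω) :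
    ball x (infDist x (frontier Ω)) ⊆ Ω := by
  set b := ball x (infDist x (frontier Ω)) with hb
  rcases (infDist_nonneg (x := x) (s := frontier Ω)).eq_or_lt with h | h
  · rw [hb, ← h]; simp
  have hdisj : ∀ y ∈ b, y ∉ frontier Ω := by
    intro y hy hyf
    have := infDist_le_dist_of_mem (x := x) hyf
    rw [hb, mem_ball, dist_comm] at hy
    linarith
  have hconn : IsPreconnected b := (convex_ball x _).isPreconnected
  have hcov : b ⊆ Ω ∪ (closure Ω)ᶜ := by
    intro y hy
    by_cases h1 : y ∈ closure Ω
    · left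
      by_contra h2
      exact hdisj y hy ⟨h1, by rwa [hΩ.interior_eq]⟩
    · right; exact h1
  refine hconn.subset_left_of_subset_union hΩ isClosed_closure.isOpen_compl ?_ hcov
    ⟨x, mem_ball_self h, hx⟩
  exact disjoint_compl_right.mono_left subset_closure

lemma main_bound (n : ℕ) (p μ : ℝ) (hp : 1 < p) :
    ∃ C : ℝ, 0 < C ∧
      ∀ Ω : Set (EuclideanSpace ℝ (Fin n)), IsOpen Ω →
        ∀ u : EuclideanSpace ℝ (Fin n) → ℝ, ContDiffOn ℝ 2 u Ω →
          (∀ x ∈ Ω, lap u x = (p + 1) * |u x - μ| ^ (p - 1) * (u x - μ)) →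
          ∀ x (d : ℝ), 0 < d → ball x d ⊆ Ω →
            |μ - u x| + ‖fderiv ℝ u x‖ ^ ((2:ℝ)/(p+1)) ≤ C * d ^ (-(2/(p-1))) := by
  have hp1 : 0 < p - 1 := by linarith
  obtain ⟨a, ha⟩ : ∃ a, a = 2 / (p - 1) := ⟨_, rfl⟩
  have ha0 : 0 < a := by rw [ha]; positivity
  obtain ⟨L, hL⟩ : ∃ L, L = 2 * a * n + 4 * a * (a + 1) := ⟨_, rfl⟩
  have hL0 : 0 < L := by rw [hL]; positivity
  obtain ⟨c, hc⟩ : ∃ c, c = (L / (p + 1)) ^ (1 / (p - 1)) := ⟨_, rfl⟩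
  have hc0 : 0 < c := by rw [hc]; positivity
  obtain ⟨D, hD⟩ : ∃ D : ℝ, D = n * (n * c + (p + 2) * c ^ p / 2) := ⟨_, rfl⟩
  have hD0 : 0 ≤ D := by rw [hD]; positivity
  refine ⟨(c + D ^ ((2:ℝ) / (p + 1))) * (1 / 4) ^ (-a), by positivity, ?_⟩
  intro Ω hΩ u hu hlap x d hd hball
  obtain ⟨ρ, hρ⟩ : ∃ ρ : ℝ, ρ = (1 / 4) * d := ⟨_, rfl⟩
  have hρ0 : 0 < ρ := by rw [hρ]; positivity
  have hval : ∀ y, closedBall y ρ ⊆ Ω → |u y - μ| ≤ c * ρ ^ (-a) := by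
    intro y hy
    have hmem : ∀ z ∈ closedBall (0 : EuclideanSpace ℝ (Fin n)) ρ, y + z ∈ Ω := by
      intro z hz
      apply hy
      simpa [mem_closedBall, dist_eq_norm] using hz
    have := ko_abs p hp ρ hρ0 (fun z => u (y + z) - μ) (fun z hz => by
        have h1 : ContDiffAt ℝ 2 u (y + z) := hu.contDiffAt (hΩ.mem_nhds (hmem z hz))
        exact (ContDiffAt.comp z h1 (contDiffAt_const.add contDiffAt_id)).sub contDiffAt_const)
      (fun z hz => by rw [lap_translate, hlap _ (hmem z hz)]) a L ha hL
    rw [← hc] at this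
    simpa using this
  have hsub : ∀ y ∈ closedBall x ρ, closedBall y ρ ⊆ Ω := by
    intro y hy
    refine Subset.trans ?_ hball
    apply closedBall_subset_ball'
    rw [mem_closedBall] at hy
    linarith
  have hx0 : |u x - μ| ≤ c * ρ ^ (-a) := hval x (hsub x (by simp [hρ0.le]))
  have hmem : ∀ z ∈ closedBall (0 : EuclideanSpace ℝ (Fin n)) ρ, x + z ∈ closedBall x ρ := by
    intro z hz
    simpa [mem_closedBall, dist_eq_norm] using hz
  have hmemΩ : ∀ z ∈ closedBall (0 : EuclideanSpace ℝ (Fin n)) ρ, x + z ∈ Ω := fun z hz =>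
    hsub x (by simp [hρ0.le]) (hmem z hz)
  obtain ⟨M, hM⟩ : ∃ M, M = c * ρ ^ (-a) := ⟨_, rfl⟩
  have hM0 : 0 < M := by rw [hM]; positivity
  have hgrad := grad_bound ρ hρ0 (fun z => u (x + z) - μ) M ((p + 2) * M ^ p) (fun z hz => by
        have h1 : ContDiffAt ℝ 2 u (x + z) := hu.contDiffAt (hΩ.mem_nhds (hmemΩ z hz))
        exact (ContDiffAt.comp z h1 (contDiffAt_const.add contDiffAt_id)).sub contDiffAt_const)
    (fun z hz => by rw [hM]; exact hval _ (hsub _ (hmem z hz)))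
    (fun z hz => by
      rw [lap_translate, hlap _ (hmemΩ z hz)]
      have h1 : |u (x + z) - μ| ≤ M := by rw [hM]; exact hval _ (hsub _ (hmem z hz))
      have h2 : |u (x + z) - μ| ^ (p - 1) ≤ M ^ (p - 1) :=
        Real.rpow_le_rpow (abs_nonneg _) h1 hp1.le
      have h3 : M ^ p = M ^ (p - 1) * M := by
        nth_rw 3 [← Real.rpow_one M]
        rw [← Real.rpow_add hM0]; ring_nf
      rw [abs_mul, abs_mul, abs_of_pos (by linarith : 0 < p + 1),
        abs_of_nonneg (Real.rpow_nonneg (abs_nonneg _) _), mul_assoc]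
      have h4 : |u (x + z) - μ| ^ (p - 1) * |u (x + z) - μ| ≤ M ^ p := by
        rw [h3]; exact mul_le_mul h2 h1 (abs_nonneg _) (by positivity)
      have h5 : 0 < M ^ p := by positivity
      have h6 := mul_le_mul_of_nonneg_left h4 (by linarith : 0 ≤ p + 1)
      linarith)
  rw [fderiv_sub_const, fderiv_comp_add_left, add_zero] at hgrad
  have e1 : M / ρ = c * ρ ^ (-a - 1) := by
    rw [hM, Real.rpow_sub_one hρ0.ne']; ring
  have e2 : M ^ p * ρ = c ^ p * ρ ^ (-a - 1) := by
    rw [hM, Real.mul_rpow hc0.le (by positivity), ← Real.rpow_mul hρ0.le]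
    have : -a - 1 = -a * p + 1 := by rw [ha]; field_simp; ring
    rw [this, Real.rpow_add hρ0, Real.rpow_one]; ring
  have hgrad2 : ‖fderiv ℝ u x‖ ≤ D * ρ ^ (-a - 1) := by
    refine hgrad.trans (le_of_eq ?_)
    calc (n:ℝ) * (n * M / ρ + (p + 2) * M ^ p * ρ / 2)
        = n * (n * (M / ρ) + (p + 2) * (M ^ p * ρ) / 2) := by ring
      _ = D * ρ ^ (-a - 1) := by rw [e1, e2, hD]; ring
  have hgrad3 : ‖fderiv ℝ u x‖ ^ ((2:ℝ) / (p + 1)) ≤ D ^ ((2:ℝ) / (p + 1)) * ρ ^ (-a) := by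
    refine (Real.rpow_le_rpow (norm_nonneg _) hgrad2 (by positivity)).trans (le_of_eq ?_)
    rw [Real.mul_rpow hD0 (by positivity), ← Real.rpow_mul hρ0.le]
    congr 2
    rw [ha]; field_simp; ring
  rw [← ha, abs_sub_comm, mul_assoc, ← Real.mul_rpow (by norm_num) hd.le, ← hρ]
  linarith

theorem stmt10 (n : ℕ) (hn : 1 ≤ n) (p μ : ℝ) (hp : 1 < p) :
    ∃ C : ℝ, 0 < C ∧
      ∀ Ω : Set (EuclideanSpace ℝ (Fin n)),
        IsOpen Ω → IsConnected Ω → Ω.Nonempty → Ω ≠ Set.univ →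
        ∀ u : EuclideanSpace ℝ (Fin n) → ℝ,
          ContDiffOn ℝ 2 u Ω →
          -- `Δu = W'(u)` with `W(t) = |t - μ|^{p+1}`, i.e. `W'(t) = (p+1)|t-μ|^{p-1}(t-μ)`
          (∀ x ∈ Ω, lap u x = (p + 1) * |u x - μ| ^ (p - 1) * (u x - μ)) →
          (∀ x ∈ Ω, |μ - u x| + ‖fderiv ℝ u x‖ ^ ((2:ℝ)/(p+1)) ≤
            C * (infDist x (frontier Ω)) ^ (-(2/(p-1)))) ∧
          (∀ R : ℝ, 0 < R → {x : EuclideanSpace ℝ (Fin n) | R < ‖x‖} ⊆ Ω →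
            ∀ x : EuclideanSpace ℝ (Fin n), 2*R ≤ ‖x‖ →
              |μ - u x| + ‖fderiv ℝ u x‖ ^ ((2:ℝ)/(p+1)) ≤ C * ‖x‖ ^ (-(2/(p-1)))) := by
  obtain ⟨C, hC, hmain⟩ := main_bound n p μ hp
  have hp1 : 0 < p - 1 := by linarith
  have hk : (1:ℝ) ≤ (1 / 2) ^ (-(2 / (p - 1))) :=
    Real.one_le_rpow_of_pos_of_le_one_of_nonpos (by norm_num) (by norm_num)
      (neg_nonpos.2 (by positivity))
  refine ⟨C * (1 / 2) ^ (-(2 / (p - 1))), by positivity, ?_⟩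
  intro Ω hΩ _ hne huniv u hu hlap
  refine ⟨?_, ?_⟩
  · intro x hx
    have hfr : (frontier Ω).Nonempty := nonempty_frontier_iff.2 ⟨hne, huniv⟩
    have hxf : x ∉ frontier Ω := fun h => h.2 (by rwa [hΩ.interior_eq])
    have hd : 0 < infDist x (frontier Ω) :=
      (isClosed_frontier.notMem_iff_infDist_pos hfr).1 hxf
    refine (hmain Ω hΩ u hu hlap x _ hd (closedBall_subset_of_frontier Ω hΩ x hx)).trans ?_
    have : 0 ≤ (infDist x (frontier Ω)) ^ (-(2 / (p - 1))) := by positivity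
    gcongr
    exact le_mul_of_one_le_right hC.le hk
  · intro R hR hext x hx
    have hx0 : 0 < ‖x‖ := by linarith
    have := hmain Ω hΩ u hu hlap x ((1 / 2) * ‖x‖) (by positivity) (by
      intro y hy
      apply hext
      rw [mem_ball, dist_eq_norm] at hy
      have h1 : ‖x‖ ≤ ‖y‖ + ‖y - x‖ := by
        have := norm_sub_le y (y - x)
        simpa using this
      show R < ‖y‖
      linarith)
    rwa [Real.mul_rpow (by norm_num) hx0.le, ← mul_assoc] at this
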